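/- The C∞ product m₂ of the Yang–Mills kinematic algebra is associative up to the homotopy m₃ on three gauge fields: for all smooth (A₁,φ₁), (A₂,φ₂), (A₃,φ₃) in K₁, m₂(m₂((A₁,φ₁),(A₂,φ₂)), (A₃,φ₃)) − m₂((A₁,φ₁), m₂((A₂,φ₂),(A₃,φ₃))) = m₁(m₃((A₁,φ₁),(A₂,φ₂),(A₃,φ₃))); equivalently, the scalar identity A₁·(A₂•A₃) − A₃·(A₁•A₂) = −∂·[(A₁·A₂)A₃ + (A₂·A₃)A₁ − 2(A₁·A₃)A₂] holds. -/

import Mathlib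

noncomputable section

/-- Points of ℝ^D. -/
abbrev Pt (D : ℕ) := Fin D → ℝ
/-- Scalar fields on ℝ^D. -/
abbrev Fn (D : ℕ) := Pt D → ℝ
/-- Vector fields on ℝ^D (components carry a lower Lorentz index). -/
abbrev Vec (D : ℕ) := Pt D → Fin D → ℝ

/-- Diagonal entries of the Minkowski metric η = diag(−1,1,…,1) (η is its own inverse). -/
def eta (D : ℕ) (μ : Fin D) : ℝ := if (μ : ℕ) = 0 then -1 else 1

/-- Partial derivative ∂_μ. -/
def pd {D : ℕ} (μ : Fin D) (f : Fn D) : Fn D := fun x => fderiv ℝ f x (Pi.single μ 1)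

/-- Minkowski pairing X·Y = η^{μν} X_μ Y_ν. -/
def dot {D : ℕ} (X Y : Vec D) : Fn D := fun x => ∑ μ, eta D μ * X x μ * Y x μ

/-- Divergence ∂·X = ∂^μ X_μ. -/
def divg {D : ℕ} (X : Vec D) : Fn D := fun x => ∑ μ, eta D μ * pd μ (fun y => X y μ) x

/-- Gradient (∂f)_μ = ∂_μ f. -/
def grad {D : ℕ} (f : Fn D) : Vec D := fun x μ => pd μ f x

/-- Wave operator □ = ∂^μ∂_μ on scalars. -/
def box {D : ℕ} (f : Fn D) : Fn D := fun x => ∑ μ, eta D μ * pd μ (pd μ f) x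

/-- Wave operator acting componentwise on vector fields. -/
def boxV {D : ℕ} (X : Vec D) : Vec D := fun x μ => box (fun y => X y μ) x

/-- Generalized Lie derivative product: (X*Y)_μ = X^ν ∂_ν Y_μ + (∂_μ X_ν − ∂_ν X_μ) Y^ν. -/
def starP {D : ℕ} (X Y : Vec D) : Vec D := fun x μ =>
  ∑ ν, eta D ν * (X x ν * pd ν (fun y => Y y μ) x
    + (pd μ (fun y => X y ν) x - pd ν (fun y => X y μ) x) * Y x ν)

/-- Bullet product X•Y = (∂·X)Y − (∂·Y)X + X*Y − Y*X. -/
def bullet {D : ℕ} (X Y : Vec D) : Vec D :=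
  fun x μ => divg X x * Y x μ - divg Y x * X x μ + starP X Y x μ - starP Y X x μ

/-- Pointwise product of scalar fields. -/
def fmul {D : ℕ} (f g : Fn D) : Fn D := fun x => f x * g x

/-- Pointwise scaling of a vector field by a scalar field. -/
def fsmul {D : ℕ} (f : Fn D) (X : Vec D) : Vec D := fun x μ => f x * X x μ

/-- Smoothness of scalar fields. -/
def SmF {D : ℕ} (f : Fn D) : Prop := ContDiff ℝ (⊤ : ℕ∞) f

/-- Smoothness of vector fields. -/
def SmV {D : ℕ} (X : Vec D) : Prop := ∀ μ, ContDiff ℝ (⊤ : ℕ∞) fun x => X x μ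

/-- Differential m₁ : K₀ → K₁, λ ↦ (∂λ, □λ). -/
def m1₀ {D : ℕ} (l : Fn D) : Vec D × Fn D := (grad l, box l)

/-- Differential m₁ : K₁ → K₂, (A,φ) ↦ (□A − ∂φ, ∂·A − φ). -/
def m1₁ {D : ℕ} (a : Vec D × Fn D) : Vec D × Fn D :=
  (fun x μ => boxV a.1 x μ - grad a.2 x μ, fun x => divg a.1 x - a.2 x)

/-- Differential m₁ : K₂ → K₃, (E,e) ↦ □e − ∂·E. -/
def m1₂ {D : ℕ} (e : Vec D × Fn D) : Fn D := fun x => box e.2 x - divg e.1 x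

/-- m₂ on K₀ ⊗ K₀. -/
def m2₀₀ {D : ℕ} (l1 l2 : Fn D) : Fn D := fmul l1 l2

/-- m₂ on K₀ ⊗ K₁: m₂(λ,(A,φ)) = (λA, ∂·(λA)). -/
def m2₀₁ {D : ℕ} (l : Fn D) (a : Vec D × Fn D) : Vec D × Fn D :=
  (fsmul l a.1, divg (fsmul l a.1))

/-- m₂ on K₁ ⊗ K₀: m₂((A,φ),λ) = (λA, ∂·(λA)). -/
def m2₁₀ {D : ℕ} (a : Vec D × Fn D) (l : Fn D) : Vec D × Fn D :=
  (fsmul l a.1, divg (fsmul l a.1))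

/-- m₂ on K₀ ⊗ K₂: m₂(λ,(E,e)) = (λ(E − ∂e), 0). -/
def m2₀₂ {D : ℕ} (l : Fn D) (e : Vec D × Fn D) : Vec D × Fn D :=
  (fun x μ => l x * (e.1 x μ - grad e.2 x μ), 0)

/-- m₂ on K₂ ⊗ K₀: m₂((E,e),λ) = (λ(E − ∂e), 0). -/
def m2₂₀ {D : ℕ} (e : Vec D × Fn D) (l : Fn D) : Vec D × Fn D :=
  (fun x μ => l x * (e.1 x μ - grad e.2 x μ), 0)

/-- m₂ on K₁ ⊗ K₁: m₂((A₁,φ₁),(A₂,φ₂)) = (A₁•A₂, 0). -/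
def m2₁₁ {D : ℕ} (a1 a2 : Vec D × Fn D) : Vec D × Fn D := (bullet a1.1 a2.1, 0)

/-- m₂ on K₁ ⊗ K₂: m₂((A,φ),(E,e)) = A·(∂e − E). -/
def m2₁₂ {D : ℕ} (a e : Vec D × Fn D) : Fn D :=
  dot a.1 (fun x μ => grad e.2 x μ - e.1 x μ)

/-- m₂ on K₂ ⊗ K₁: m₂((E,e),(A,φ)) = A·(∂e − E). -/
def m2₂₁ {D : ℕ} (e a : Vec D × Fn D) : Fn D :=
  dot a.1 (fun x μ => grad e.2 x μ - e.1 x μ)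

/-- m₂ on K₀ ⊗ K₃: m₂(λ,N) = λN. -/
def m2₀₃ {D : ℕ} (l N : Fn D) : Fn D := fmul l N

/-- m₂ on K₃ ⊗ K₀: m₂(N,λ) = λN. -/
def m2₃₀ {D : ℕ} (N l : Fn D) : Fn D := fmul l N

/-- The three-product m₃ on K₁ ⊗ K₁ ⊗ K₁:
m₃((A₁,φ₁),(A₂,φ₂),(A₃,φ₃)) = ((A₁·A₂)A₃ + (A₂·A₃)A₁ − 2(A₁·A₃)A₂, 0) ∈ K₂. -/
def m3 {D : ℕ} (a1 a2 a3 : Vec D × Fn D) : Vec D × Fn D :=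
  (fun x μ => dot a1.1 a2.1 x * a3.1 x μ + dot a2.1 a3.1 x * a1.1 x μ
      - 2 * dot a1.1 a3.1 x * a2.1 x μ, 0)

/-- The contraction `Y · (X·∂)Z = X^ν Y^μ ∂_ν Z_μ`. -/
def contractGrad {D : ℕ} (X Y Z : Vec D) : Fn D := fun x =>
  ∑ μ, ∑ ν, eta D μ * eta D ν * X x ν * Y x μ * pd ν (fun y => Z y μ) x

lemma SmV.differentiableAt {D : ℕ} {X : Vec D} (hX : SmV X) (μ : Fin D) (x : Pt D) :
    DifferentiableAt ℝ (fun y => X y μ) x :=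
  (hX μ).differentiable (by simp) x

lemma pd_mul {D : ℕ} (μ : Fin D) {f g : Fn D} {x : Pt D} (hf : DifferentiableAt ℝ f x)
    (hg : DifferentiableAt ℝ g x) :
    pd μ (fun y => f y * g y) x = f x * pd μ g x + g x * pd μ f x := by
  simp [pd, fderiv_fun_mul hf hg]

lemma pd_zero {D : ℕ} (μ : Fin D) : pd μ (0 : Fn D) = 0 := by
  funext x
  simp [pd]

lemma differentiableAt_dot {D : ℕ} {X Y : Vec D} (hX : SmV X) (hY : SmV Y) (x : Pt D) :
    DifferentiableAt ℝ (dot X Y) x := by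
  unfold dot
  exact DifferentiableAt.fun_sum fun μ _ =>
    ((hX.differentiableAt μ x).const_mul _).mul (hY.differentiableAt μ x)

lemma pd_dot {D : ℕ} (ν : Fin D) {X Y : Vec D} (hX : SmV X) (hY : SmV Y) (x : Pt D) :
    pd ν (dot X Y) x =
      ∑ μ, eta D μ * (X x μ * pd ν (fun y => Y y μ) x + Y x μ * pd ν (fun y => X y μ) x) := by
  have h (μ : Fin D) :
      DifferentiableAt ℝ (fun y => eta D μ * X y μ * Y y μ) x :=
    ((hX.differentiableAt μ x).const_mul _).mul (hY.differentiableAt μ x)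
  unfold pd dot
  rw [fderiv_fun_sum fun μ _ => h μ, sum_apply]
  refine Finset.sum_congr rfl fun μ _ => ?_
  rw [fderiv_fun_mul ((hX.differentiableAt μ x).const_mul _) (hY.differentiableAt μ x),
    fderiv_const_mul (hX.differentiableAt μ x)]
  simp only [add_apply, smul_apply, smul_eq_mul]
  ring

lemma divg_dot_mul {D : ℕ} {X Y Z : Vec D} (hX : SmV X) (hY : SmV Y) (hZ : SmV Z) (x : Pt D) :
    divg (fun y μ => dot X Y y * Z y μ) x =
      dot X Y x * divg Z x + contractGrad Z X Y x + contractGrad Z Y X x := by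
  unfold divg contractGrad
  rw [Finset.mul_sum, Finset.sum_comm, add_assoc,
    Finset.sum_comm (s := Finset.univ) (f := fun μ ν =>
      eta D μ * eta D ν * Z x ν * Y x μ * pd ν (fun y => X y μ) x),
    ← Finset.sum_add_distrib, ← Finset.sum_add_distrib]
  refine Finset.sum_congr rfl fun ν _ => ?_
  rw [pd_mul ν (differentiableAt_dot hX hY x) (hZ.differentiableAt ν x), pd_dot ν hX hY x,
    ← Finset.sum_add_distrib, mul_add, Finset.mul_sum, Finset.mul_sum]
  congr 1
  · ring
  · refine Finset.sum_congr rfl fun μ _ => ?_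
    ring

lemma dot_starP {D : ℕ} (X Y Z : Vec D) (x : Pt D) :
    dot Z (starP X Y) x =
      contractGrad X Z Y x + contractGrad Z Y X x - contractGrad Y Z X x := by
  have h : contractGrad Z Y X x =
      ∑ μ, ∑ ν, eta D ν * eta D μ * Z x μ * Y x ν * pd μ (fun y => X y ν) x :=
    Finset.sum_comm
  rw [h]
  simp only [dot, starP, contractGrad, Finset.mul_sum, ← Finset.sum_add_distrib,
    ← Finset.sum_sub_distrib]
  refine Finset.sum_congr rfl fun μ _ => Finset.sum_congr rfl fun ν _ => ?_
  ring

lemma dot_comm {D : ℕ} (X Y : Vec D) : dot X Y = dot Y X := by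
  funext x
  exact Finset.sum_congr rfl fun μ _ => by ring

lemma dot_bullet {D : ℕ} (X Y Z : Vec D) (x : Pt D) :
    dot Z (bullet X Y) x = divg X x * dot Z Y x - divg Y x * dot Z X x
      + dot Z (starP X Y) x - dot Z (starP Y X) x := by
  simp only [dot, bullet, Finset.mul_sum, ← Finset.sum_add_distrib, ← Finset.sum_sub_distrib]
  exact Finset.sum_congr rfl fun μ _ => by ring

lemma divg_add_sub_two_mul {D : ℕ} {X Y Z : Vec D} {x : Pt D}
    (hX : ∀ μ, DifferentiableAt ℝ (fun y => X y μ) x)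
    (hY : ∀ μ, DifferentiableAt ℝ (fun y => Y y μ) x)
    (hZ : ∀ μ, DifferentiableAt ℝ (fun y => Z y μ) x) :
    divg (fun y μ => X y μ + Y y μ - 2 * Z y μ) x = divg X x + divg Y x - 2 * divg Z x := by
  simp only [divg, Finset.mul_sum, ← Finset.sum_add_distrib, ← Finset.sum_sub_distrib]
  refine Finset.sum_congr rfl fun μ _ => ?_
  unfold pd
  rw [fderiv_fun_sub ((hX μ).fun_add (hY μ)) ((hZ μ).const_mul 2), fderiv_fun_add (hX μ) (hY μ),
    fderiv_const_mul (hZ μ)]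
  simp only [add_apply, sub_apply,
    smul_apply, smul_eq_mul]
  ring

/-- The product `m₂` is associative up to the divergence of `m₃`, as a scalar identity. -/
lemma dot_bullet_sub_dot_bullet {D : ℕ} {A B C : Vec D} (hA : SmV A) (hB : SmV B) (hC : SmV C) :
    dot A (bullet B C) - dot C (bullet A B) =
      -(divg (fun x μ => dot A B x * C x μ + dot B C x * A x μ - 2 * dot A C x * B x μ)) := by
  funext x
  have key := divg_add_sub_two_mul
    (fun μ => (differentiableAt_dot hA hB x).fun_mul (hC.differentiableAt μ x))
    (fun μ => (differentiableAt_dot hB hC x).fun_mul (hA.differentiableAt μ x))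
    (fun μ => (differentiableAt_dot hA hC x).fun_mul (hB.differentiableAt μ x))
  rw [divg_dot_mul hA hB hC, divg_dot_mul hB hC hA, divg_dot_mul hA hC hB] at key
  simp only [Pi.sub_apply, Pi.neg_apply, mul_assoc]
  rw [key, dot_bullet, dot_bullet, dot_starP, dot_starP, dot_starP, dot_starP,
    dot_comm C B, dot_comm C A]
  ring

lemma dot_grad_zero_sub {D : ℕ} (X Y : Vec D) :
    dot X (fun x μ => grad 0 x μ - Y x μ) = -dot X Y := by
  funext x
  simp [dot, grad, pd_zero]

lemma box_zero {D : ℕ} : box (0 : Fn D) = 0 := by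
  funext x
  simp [box, pd_zero]

/-- the C∞ product m₂ is associative up to the homotopy m₃ on three gauge
fields: m₂(m₂(a₁,a₂),a₃) − m₂(a₁,m₂(a₂,a₃)) = m₁(m₃(a₁,a₂,a₃)); equivalently the scalar
identity A₁·(A₂•A₃) − A₃·(A₁•A₂) = −∂·[(A₁·A₂)A₃ + (A₂·A₃)A₁ − 2(A₁·A₃)A₂]. -/
theorem m2_homotopy_associative_on_gauge_fields {D : ℕ} (hD : 1 ≤ D)
    (a1 a2 a3 : Vec D × Fn D)
    (ha1V : SmV a1.1) (ha1F : SmF a1.2) (ha2V : SmV a2.1) (ha2F : SmF a2.2)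
    (ha3V : SmV a3.1) (ha3F : SmF a3.2) :
    m2₂₁ (m2₁₁ a1 a2) a3 - m2₁₂ a1 (m2₁₁ a2 a3) = m1₂ (m3 a1 a2 a3) ∧
    dot a1.1 (bullet a2.1 a3.1) - dot a3.1 (bullet a1.1 a2.1) =
      -(divg (fun x μ => dot a1.1 a2.1 x * a3.1 x μ + dot a2.1 a3.1 x * a1.1 x μ
          - 2 * dot a1.1 a3.1 x * a2.1 x μ)) := by
  have h := dot_bullet_sub_dot_bullet ha1V ha2V ha3V
  refine ⟨?_, h⟩
  have hm : m1₂ (m3 a1 a2 a3) = -divg (m3 a1 a2 a3).1 := by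
    funext x
    simp [m1₂, m3, box_zero]
  rw [hm]
  refine Eq.trans ?_ h
  simp only [m2₂₁, m2₁₂, m2₁₁, dot_grad_zero_sub]
  abel
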